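/- Fix finite nonempty types α and β, positive semidefinite matrices P₀, P₁ : Matrix (α × β) (α × β) ℂ, and a positive semidefinite ρ : Matrix β β ℂ with trace 1 such that P₀ + P₁ = I_α ⊗ ρ. Suppose Y : Matrix β β ℂ is Hermitian with I_α ⊗ Y ≥ P₁ and Y ≤ ρ in the Loewner order, and let p := re (Tr Y). Then for every n ≥ 1, every 0 ≤ k ≤ n, and every n-repetition strategy X: re (∑_{s ∈ Σ^n_{≥k}} Tr ((⨂ⱼ P_{s j}) * X)) ≤ ∑_{t = k}^{n} (n.choose t) * p^t * (1 − p)^(n−t). That is, when a dual witness Y dominated by ρ exists, the probability that Bob wins at least k of n parallel repetitions is at most the binomial tail ∑_{t≥k} C(n,t) p^t (1−p)^{n−t}. -/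

import Mathlib

open Matrix Finset ComplexOrder

/-- The `n`-fold Kronecker product of matrices `M 0, …, M (n-1)`, indexed by `Fin n → I`. -/
noncomputable def nKron {n : ℕ} {I : Type*} [Fintype I] (M : Fin n → Matrix I I ℂ) :
    Matrix (Fin n → I) (Fin n → I) ℂ :=
  fun f g => ∏ j, M j (f j) (g j)

/-- The set `Σ^n_{≥k}` of binary strings of length `n` with at least `k` ones. -/
def SigmaGe (n k : ℕ) : Finset (Fin n → Fin 2) :=
  Finset.univ.filter fun s => k ≤ (Finset.univ.filter fun j => s j = 1).card

/-- An `n`-repetition strategy for Bob. -/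
def IsParStrategy {α β : Type*} [Fintype α] [Fintype β] [DecidableEq β] (n : ℕ)
    (X : Matrix (Fin n → α × β) (Fin n → α × β) ℂ) : Prop :=
  X.PosSemidef ∧
    ∀ b b' : Fin n → β,
      ∑ a : Fin n → α, X (fun j => (a j, b j)) (fun j => (a j, b' j)) =
        if b = b' then 1 else 0

namespace Matrix

/-- The trace of a product of two positive semidefinite matrices is nonnegative. -/
theorem PosSemidef.trace_mul_nonneg {I : Type*} [Fintype I] {A B : Matrix I I ℂ}
    (hA : A.PosSemidef) (hB : B.PosSemidef) : 0 ≤ (A * B).trace := by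
  classical
  open scoped MatrixOrder in
  obtain ⟨C, rfl⟩ := CStarAlgebra.nonneg_iff_eq_star_mul_self.mp hB.nonneg
  rw [← Matrix.mul_assoc, Matrix.trace_mul_comm, ← Matrix.mul_assoc, star_eq_conjTranspose]
  exact (hA.mul_mul_conjTranspose_same C).trace_nonneg

theorem IsHermitian.ofReal_re_trace {I : Type*} [Fintype I] {A : Matrix I I ℂ}
    (hA : A.IsHermitian) : ((A.trace.re : ℝ) : ℂ) = A.trace := by
  rw [← Complex.conj_eq_iff_re, starRingEnd_apply, ← trace_conjTranspose, hA.eq]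

end Matrix

section

variable {I : Type*} [Fintype I] {n : ℕ}

theorem nKron_succ (M : Fin (n + 1) → Matrix I I ℂ) :
    nKron M = (kroneckerMap (· * ·) (M 0) (nKron fun j => M j.succ)).submatrix
      (fun f => (f 0, fun j => f j.succ)) (fun f => (f 0, fun j => f j.succ)) := by
  ext f g
  simp [nKron, Fin.prod_univ_succ]

theorem nKron_posSemidef (M : Fin n → Matrix I I ℂ) (hM : ∀ j, (M j).PosSemidef) :
    (nKron M).PosSemidef := by
  induction n with
  | zero =>
    have h : nKron M = vecMulVec (fun _ => 1) (star fun _ => 1) := by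
      ext f g
      simp [nKron, vecMulVec_apply]
    rw [h]
    exact posSemidef_vecMulVec_self_star _
  | succ n ih =>
    rw [nKron_succ]
    exact ((hM 0).kronecker (ih _ fun j => hM j.succ)).submatrix _

/-- The operator of the event that at least `k` of `n` coordinates give outcome `1`,
for the pair of effects `D 0`, `D 1`. -/
noncomputable def atLeastOp (n k : ℕ) (D : Fin 2 → Matrix I I ℂ) :
    Matrix (Fin n → I) (Fin n → I) ℂ :=
  ∑ s ∈ SigmaGe n k, nKron fun j => D (s j)

theorem atLeastOp_succ (n k : ℕ) (D : Fin 2 → Matrix I I ℂ) :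
    atLeastOp (n + 1) k D =
      (kroneckerMap (· * ·) (D 0) (atLeastOp n k D) +
        kroneckerMap (· * ·) (D 1) (atLeastOp n (k - 1) D)).submatrix
      (fun f => (f 0, fun j => f j.succ)) (fun f => (f 0, fun j => f j.succ)) := by
  have hcard (x : Fin 2) (s : Fin n → Fin 2) :
      (univ.filter fun j => (Fin.cons x s : Fin (n + 1) → Fin 2) j = 1).card =
        (if x = 1 then 1 else 0) + (univ.filter fun j => s j = 1).card := by
    simp only [Finset.card_filter, Fin.sum_univ_succ, Fin.cons_zero, Fin.cons_succ]
  ext f g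
  simp only [atLeastOp, SigmaGe, Finset.sum_filter, Matrix.sum_apply, submatrix_apply,
    Matrix.add_apply, kroneckerMap_apply, Finset.mul_sum]
  rw [← (Fin.consEquiv fun _ => Fin 2).sum_comp, Fintype.sum_prod_type, Fin.sum_univ_two]
  congr 1 <;> refine Finset.sum_congr rfl fun s _ => ?_
  · simp only [Fin.consEquiv_apply, hcard, nKron_succ]
    by_cases h : k ≤ (univ.filter fun j => s j = 1).card <;> simp [h]
  · simp only [Fin.consEquiv_apply, hcard, nKron_succ]
    by_cases h : k - 1 ≤ (univ.filter fun j => s j = 1).card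
    · have h' : k ≤ 1 + (univ.filter fun j => s j = 1).card := by omega
      simp [h, h']
    · have h' : ¬ k ≤ 1 + (univ.filter fun j => s j = 1).card := by omega
      simp [h, h']

theorem atLeastOp_posSemidef (n k : ℕ) {D : Fin 2 → Matrix I I ℂ} (hD : ∀ i, (D i).PosSemidef) :
    (atLeastOp n k D).PosSemidef :=
  posSemidef_sum _ fun _ _ => nKron_posSemidef _ fun _ => hD _

theorem atLeastOp_sub_posSemidef_of_le {k l : ℕ} (hkl : k ≤ l) {D : Fin 2 → Matrix I I ℂ}
    (hD : ∀ i, (D i).PosSemidef) : (atLeastOp n k D - atLeastOp n l D).PosSemidef := by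
  have hsub : SigmaGe n l ⊆ SigmaGe n k := fun s hs => by
    simp only [SigmaGe, Finset.mem_filter, Finset.mem_univ, true_and] at hs ⊢
    exact hkl.trans hs
  rw [atLeastOp, atLeastOp, ← Finset.sum_sdiff hsub, add_sub_cancel_right]
  exact posSemidef_sum _ fun _ _ => nKron_posSemidef _ fun _ => hD _

/-- Shifting weight from outcome `0` to outcome `1` increases the operator of the event
of at least `k` ones. -/
theorem atLeastOp_sub_posSemidef {D E : Fin 2 → Matrix I I ℂ} (hD : ∀ i, (D i).PosSemidef)
    (hE : ∀ i, (E i).PosSemidef) (hsum : D 0 + D 1 = E 0 + E 1) (h : (E 1 - D 1).PosSemidef)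
    (n k : ℕ) : (atLeastOp n k E - atLeastOp n k D).PosSemidef := by
  induction n generalizing k with
  | zero =>
    have : atLeastOp 0 k E = atLeastOp 0 k D := by
      refine Finset.sum_congr rfl fun s _ => ?_
      ext f g
      simp [nKron]
    rw [this, sub_self]
    exact PosSemidef.zero
  | succ n ih =>
    have hE0 : E 0 = D 0 + D 1 - E 1 := by rw [hsum, add_sub_cancel_right]
    have key : atLeastOp (n + 1) k E - atLeastOp (n + 1) k D =
        (kroneckerMap (· * ·) (E 0) (atLeastOp n k E - atLeastOp n k D) +
          kroneckerMap (· * ·) (E 1) (atLeastOp n (k - 1) E - atLeastOp n (k - 1) D) +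
          kroneckerMap (· * ·) (E 1 - D 1)
            (atLeastOp n (k - 1) D - atLeastOp n k D)).submatrix
        (fun f => (f 0, fun j => f j.succ)) (fun f => (f 0, fun j => f j.succ)) := by
      rw [atLeastOp_succ, atLeastOp_succ, hE0]
      ext f g
      simp only [submatrix_apply, Matrix.add_apply, Matrix.sub_apply, kroneckerMap_apply]
      ring
    rw [key]
    exact ((((hE 0).kronecker (ih k)).add ((hE 1).kronecker (ih (k - 1)))).add
      (h.kronecker (atLeastOp_sub_posSemidef_of_le (Nat.sub_le k 1) hD))).submatrix _

end

/-- Against a strategy, a product of operators `I ⊗ Z j` evaluates to the product of traces. -/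
theorem IsParStrategy.trace_nKron_mul {α β : Type*} [Fintype α] [Fintype β] [DecidableEq α]
    [DecidableEq β] {n : ℕ} {X : Matrix (Fin n → α × β) (Fin n → α × β) ℂ}
    (hX : IsParStrategy n X) (Z : Fin n → Matrix β β ℂ) :
    (nKron (fun j => kroneckerMap (· * ·) (1 : Matrix α α ℂ) (Z j)) * X).trace =
      ∏ j, (Z j).trace := by
  let e : (Fin n → α × β) ≃ (Fin n → α) × (Fin n → β) :=
    Equiv.arrowProdEquivProdArrow (Fin n) (fun _ => α) fun _ => β
  have hentry (a a' : Fin n → α) (b b' : Fin n → β) :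
      nKron (fun j => kroneckerMap (· * ·) (1 : Matrix α α ℂ) (Z j))
        (e.symm (a, b)) (e.symm (a', b')) = if a = a' then ∏ j, Z j (b j) (b' j) else 0 := by
    have h1 : (∏ j, (1 : Matrix α α ℂ) (a j) (a' j)) = if a = a' then 1 else 0 := by
      simp only [Matrix.one_apply, Finset.prod_ite_zero, funext_iff]
      simp
    change ∏ j, (1 : Matrix α α ℂ) (a j) (a' j) * Z j (b j) (b' j) = _
    rw [Finset.prod_mul_distrib, h1]
    simp
  calc _ = ∑ f, ∑ g, nKron (fun j => kroneckerMap (· * ·) (1 : Matrix α α ℂ) (Z j)) f g * X g f :=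
        by simp only [Matrix.trace, Matrix.diag_apply, Matrix.mul_apply]
    _ = ∑ a, ∑ b, ∑ b', (∏ j, Z j (b j) (b' j)) * X (e.symm (a, b')) (e.symm (a, b)) := by
        rw [← e.symm.sum_comp, Fintype.sum_prod_type]
        refine Finset.sum_congr rfl fun a _ => Finset.sum_congr rfl fun b _ => ?_
        rw [← e.symm.sum_comp, Fintype.sum_prod_type, Finset.sum_comm]
        simp only [hentry, ite_mul, zero_mul, Finset.sum_ite_eq, Finset.mem_univ, if_true]
    _ = ∑ b, ∑ b', (∏ j, Z j (b j) (b' j)) * ∑ a, X (e.symm (a, b')) (e.symm (a, b)) := by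
        rw [Finset.sum_comm]
        refine Finset.sum_congr rfl fun b _ => ?_
        rw [Finset.sum_comm]
        simp only [Finset.mul_sum]
    _ = ∑ b : Fin n → β, ∏ j, Z j (b j) (b j) := by
        refine Finset.sum_congr rfl fun b _ => ?_
        have h (b' : Fin n → β) : ∑ a, X (e.symm (a, b')) (e.symm (a, b)) =
            if b' = b then 1 else 0 := hX.2 b' b
        simp [h]
    _ = ∏ j, (Z j).trace := by
        simp only [Matrix.trace, Matrix.diag_apply, Fintype.prod_sum]

/-- The weight of the strings with at least `k` ones under a product weight is a binomial tail. -/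
theorem sum_SigmaGe_prod {R : Type*} [CommRing R] (n k : ℕ) (x y : R) :
    ∑ s ∈ SigmaGe n k, ∏ j, (if s j = 1 then x else y) =
      ∑ t ∈ Finset.Icc k n, (n.choose t : R) * x ^ t * y ^ (n - t) := by
  let e : Finset (Fin n) ≃ (Fin n → Fin 2) :=
    { toFun := fun u j => if j ∈ u then 1 else 0
      invFun := fun s => univ.filter fun j => s j = 1
      left_inv := fun u => by ext j; simp
      right_inv := fun s => by
        ext j
        simp only [Finset.mem_filter, Finset.mem_univ, true_and]
        split_ifs with h <;> omega }
  have hmem (u : Finset (Fin n)) (j : Fin n) : e u j = 1 ↔ j ∈ u := by simp [e]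
  rw [SigmaGe, Finset.sum_filter, ← e.sum_comp]
  have hterm (u : Finset (Fin n)) :
      (if k ≤ (univ.filter fun j => e u j = 1).card then
        ∏ j, (if e u j = 1 then x else y) else 0) =
      if k ≤ u.card then x ^ u.card * y ^ (n - u.card) else 0 := by
    have hc : (univ.filter fun j => j ∉ u).card = n - u.card := by
      rw [← Finset.compl_filter, Finset.card_compl]
      simp
    simp only [hmem, Finset.prod_ite, Finset.prod_const, hc]
    simp
  simp only [hterm]
  rw [← Finset.powerset_univ,
    Finset.sum_powerset_apply_card fun m => if k ≤ m then x ^ m * y ^ (n - m) else 0]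
  have hIcc : Finset.Icc k n = (Finset.range (n + 1)).filter fun m => k ≤ m := by
    ext m
    simp only [Finset.mem_Icc, Finset.mem_filter, Finset.mem_range]
    omega
  rw [hIcc, Finset.sum_filter, Finset.card_univ, Fintype.card_fin]
  refine Finset.sum_congr rfl fun m _ => ?_
  split_ifs <;> simp [mul_assoc]

theorem stmt12 {α β : Type*} [Fintype α] [Fintype β] [DecidableEq α] [DecidableEq β]
    [Nonempty α] [Nonempty β]
    (P₀ P₁ : Matrix (α × β) (α × β) ℂ) (hP₀ : P₀.PosSemidef) (hP₁ : P₁.PosSemidef)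
    (ρ : Matrix β β ℂ) (hρ : ρ.PosSemidef) (hρtr : ρ.trace = 1)
    (hPsum : P₀ + P₁ =
      Matrix.of fun p q : α × β => (if p.1 = q.1 then (1 : ℂ) else 0) * ρ p.2 q.2)
    (Y : Matrix β β ℂ) (hY : Y.IsHermitian)
    (hYP : ((Matrix.of fun p q : α × β =>
        (if p.1 = q.1 then (1 : ℂ) else 0) * Y p.2 q.2) - P₁).PosSemidef)
    (hYρ : (ρ - Y).PosSemidef)
    (p : ℝ) (hp : p = Y.trace.re)
    (n : ℕ) (hn : 1 ≤ n) (k : ℕ) (hk : k ≤ n)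
    (X : Matrix (Fin n → α × β) (Fin n → α × β) ℂ) (hX : IsParStrategy n X) :
    (∑ s ∈ SigmaGe n k,
        ((nKron (fun j => if s j = 1 then P₁ else P₀)) * X).trace).re ≤
      ∑ t ∈ Finset.Icc k n, (n.choose t : ℝ) * p ^ t * (1 - p) ^ (n - t) := by
  have hone (Z : Matrix β β ℂ) :
      (Matrix.of fun p q : α × β => (if p.1 = q.1 then (1 : ℂ) else 0) * Z p.2 q.2) =
        kroneckerMap (· * ·) (1 : Matrix α α ℂ) Z := by
    ext f g
    simp [Matrix.one_apply]
  rw [hone] at hPsum hYP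
  let D : Fin 2 → Matrix (α × β) (α × β) ℂ := fun i => if i = 1 then P₁ else P₀
  let W : Fin 2 → Matrix β β ℂ := fun i => if i = 1 then Y else ρ - Y
  let E : Fin 2 → Matrix (α × β) (α × β) ℂ :=
    fun i => kroneckerMap (· * ·) (1 : Matrix α α ℂ) (W i)
  have hD : ∀ i, (D i).PosSemidef := Fin.forall_fin_two.2 ⟨hP₀, hP₁⟩
  have hE : ∀ i, (E i).PosSemidef := by
    refine Fin.forall_fin_two.2 ⟨PosSemidef.one.kronecker hYρ, ?_⟩
    have h := hYP.add hP₁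
    rwa [sub_add_cancel] at h
  have hsum : D 0 + D 1 = E 0 + E 1 := by
    change P₀ + P₁ = kroneckerMap (· * ·) (1 : Matrix α α ℂ) (ρ - Y) +
      kroneckerMap (· * ·) (1 : Matrix α α ℂ) Y
    rw [hPsum]
    ext f g
    simp only [Matrix.add_apply, kroneckerMap_apply, Matrix.sub_apply]
    ring
  have htrace (F : Fin 2 → Matrix (α × β) (α × β) ℂ) :
      (atLeastOp n k F * X).trace = ∑ s ∈ SigmaGe n k, (nKron (fun j => F (s j)) * X).trace := by
    rw [atLeastOp, Finset.sum_mul, Matrix.trace_sum]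
  have hle := (Complex.le_def.1
    ((atLeastOp_sub_posSemidef hD hE hsum hYP n k).trace_mul_nonneg hX.1)).1
  rw [Matrix.sub_mul, Matrix.trace_sub, Complex.sub_re, Complex.zero_re, sub_nonneg,
    htrace, htrace] at hle
  refine hle.trans_eq ?_
  have hYtr : Y.trace = (p : ℂ) := by rw [hp, hY.ofReal_re_trace]
  have hW (i : Fin 2) : (W i).trace = ((if i = 1 then p else 1 - p : ℝ) : ℂ) := by
    by_cases hi : i = 1 <;> simp [W, hi, hYtr, hρtr, Matrix.trace_sub]
  have hval (s : Fin n → Fin 2) : (nKron (fun j => E (s j)) * X).trace =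
      ((∏ j, (if s j = 1 then p else 1 - p) : ℝ) : ℂ) := by
    rw [hX.trace_nKron_mul fun j => W (s j)]
    simp only [hW, Complex.ofReal_prod]
  simp only [hval]
  rw [← Complex.ofReal_sum, Complex.ofReal_re, sum_SigmaGe_prod]
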